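/- The N-th moment operator of the real sphere, E_{Haar(R^d)}(|φ⟩⟨φ|)^{⊗N}, equals (Γ(d/2)/(2^N Γ(N + d/2))) Σ_{M ∈ M_{2N}} σ_M, where M_{2N} ranges over perfect matchings of {1,...,2N} and σ_M is the corresponding operator on (C^d)^{⊗N}. -/

import Mathlib

open MeasureTheory
open scoped Classical

section aux
variable {ι : Type*} [Fintype ι] [DecidableEq ι] {d : ℕ}

noncomputable def Wset (h : ι → Fin d) (S : Finset ι) : Finset (Equiv.Perm ι) :=
  Finset.univ.filter fun π : Equiv.Perm ι =>
    Function.Involutive π ∧ (∀ i, π i ≠ i ↔ i ∈ S) ∧ ∀ i, h i = h (π i)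

lemma mem_Wset (h : ι → Fin d) (S : Finset ι) (π : Equiv.Perm ι) : π ∈ Wset h S ↔
    Function.Involutive π ∧ (∀ i, π i ≠ i ↔ i ∈ S) ∧ ∀ i, h i = h (π i) := by
  simp [Wset]

lemma W_rec (h : ι → Fin d) (S : Finset ι) (a : ι) (ha : a ∈ S) :
    (Wset h S).card = ∑ b ∈ S.erase a, if h b = h a then (Wset h ((S.erase a).erase b)).card else 0 := by
  rw [Finset.card_eq_sum_card_fiberwise (f := fun π => π a) (t := S.erase a)]
  · refine Finset.sum_congr rfl fun b hb => ?_
    have hab : a ≠ b := by grind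
    have hbS : b ∈ S := by grind
    split_ifs with hh
    · refine Finset.card_bij' (fun π _ => Equiv.swap a b * π) (fun π _ => Equiv.swap a b * π) ?_ ?_ ?_ ?_
      · intro π hπ
        rw [Finset.mem_filter, mem_Wset] at hπ
        rw [mem_Wset]
        simp only [Function.Involutive, Equiv.Perm.mul_apply, Equiv.swap_apply_def, Finset.mem_erase] at hπ ⊢
        obtain ⟨⟨h1, h2, h3⟩, h4⟩ := hπ
        have h5 : π b = a := by rw [← h4, h1]
        refine ⟨fun x => ?_, fun x => ?_, fun x => ?_⟩
        · have := h1 x; grind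
        · have := h1 x; have := h2 x; grind
        · have := h1 x; have := h3 x; grind
      · intro π hπ
        rw [Finset.mem_filter, mem_Wset]
        rw [mem_Wset] at hπ
        simp only [Function.Involutive, Equiv.Perm.mul_apply, Equiv.swap_apply_def, Finset.mem_erase] at hπ ⊢
        obtain ⟨h1, h2, h3⟩ := hπ
        have h4 : π a = a := by have := h2 a; grind
        have h5 : π b = b := by have := h2 b; grind
        refine ⟨⟨fun x => ?_, fun x => ?_, fun x => ?_⟩, ?_⟩
        · have := h1 x; grind
        · have := h1 x; have := h2 x; grind
        · have := h1 x; have := h3 x; grind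
        · grind
      · intro π _; simp [← mul_assoc]
      · intro π _; simp [← mul_assoc]
    · rw [Finset.card_eq_zero, Finset.filter_eq_empty_iff]
      intro π hπ he
      rw [mem_Wset] at hπ
      have := hπ.2.2 a
      grind
  · intro π hπ
    rw [Finset.mem_coe, mem_Wset] at hπ
    have h1 := hπ.1 a
    have h2 := hπ.2.1
    have := h2 a
    have := h2 (π a)
    rw [Finset.mem_coe, Finset.mem_erase]
    grind

lemma W_empty (h : ι → Fin d) : (Wset h ∅).card = 1 := by
  rw [Finset.card_eq_one]
  refine ⟨1, ?_⟩
  ext π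
  rw [mem_Wset, Finset.mem_singleton]
  constructor
  · rintro ⟨-, h2, -⟩
    ext x; simpa using h2 x
  · rintro rfl; simp [Function.Involutive]

def rA (i j : Fin d) : Matrix (Fin d) (Fin d) ℝ := Matrix.single i i 1 + Matrix.single j j 1
def rJ (i j : Fin d) : Matrix (Fin d) (Fin d) ℝ := Matrix.single j i 1 - Matrix.single i j 1
noncomputable def rot (i j : Fin d) (θ : ℝ) : Matrix (Fin d) (Fin d) ℝ :=
  1 + (Real.cos θ - 1) • rA i j + Real.sin θ • rJ i j

lemma rot_mem (i j : Fin d) (hij : i ≠ j) (θ : ℝ) : rot i j θ ∈ Matrix.orthogonalGroup (Fin d) ℝ := by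
  rw [Matrix.mem_orthogonalGroup_iff]
  change rot i j θ * (rot i j θ).transpose = 1
  have hAA : rA i j * rA i j = rA i j := by
    simp [rA, add_mul, mul_add, Matrix.single_mul_single_of_ne, hij, hij.symm]
  have hAJ : rA i j * rJ i j = rJ i j := by
    simp [rA, rJ, add_mul, mul_sub, Matrix.single_mul_single_of_ne, hij, hij.symm]; try abel
  have hJA : rJ i j * rA i j = rJ i j := by
    simp [rA, rJ, sub_mul, mul_add, Matrix.single_mul_single_of_ne, hij, hij.symm]; try abel
  have hJJ : rJ i j * rJ i j = - rA i j := by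
    simp [rA, rJ, sub_mul, mul_sub, Matrix.single_mul_single_of_ne, hij, hij.symm]; try abel
  have hA : (rA i j).transpose = rA i j := by simp [rA]
  have hJ : (rJ i j).transpose = - rJ i j := by simp [rJ]
  have hst : (rot i j θ).transpose = 1 + (Real.cos θ - 1) • rA i j - Real.sin θ • rJ i j := by
    simp only [rot, Matrix.transpose_add, Matrix.transpose_smul, hA, hJ, Matrix.transpose_one]
    simp [sub_eq_add_neg]
  rw [hst, rot]
  have e : (1 + (Real.cos θ - 1) • rA i j + Real.sin θ • rJ i j) * (1 + (Real.cos θ - 1) • rA i j - Real.sin θ • rJ i j)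
     = 1 + (Real.cos θ ^ 2 - 1 + Real.sin θ ^2) • rA i j := by
    simp only [add_mul, mul_add, mul_sub, one_mul, mul_one, smul_mul_assoc, mul_smul_comm, hAA, hAJ, hJA, hJJ]
    module
  rw [e, show Real.cos θ ^ 2 - 1 + Real.sin θ ^2 = 0 by linarith [Real.sin_sq_add_cos_sq θ]]
  simp

lemma rJ_mulVec (i j : Fin d) (x : Fin d → ℝ) (p : Fin d) :
    (rJ i j).mulVec x p = (if p = j then x i else 0) - (if p = i then x j else 0) := by
  simp [rJ, Matrix.sub_mulVec, Matrix.single_mulVec, Function.update_apply]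

lemma int_cont (ν : Measure (Fin d → ℝ)) [IsProbabilityMeasure ν]
    (hs : ∀ᵐ x ∂ν, ∑ i, x i ^ 2 = 1) (f : (Fin d → ℝ) → ℝ) (hf : Continuous f) : Integrable f ν := by
  obtain ⟨C, hC⟩ := (isCompact_closedBall (0 : Fin d → ℝ) 1).exists_bound_of_continuousOn hf.continuousOn
  refine Integrable.of_bound hf.aestronglyMeasurable C ?_
  filter_upwards [hs] with x hx
  refine hC x ?_
  rw [mem_closedBall_zero_iff, pi_norm_le_iff_of_nonneg zero_le_one]
  intro i
  have : x i ^ 2 ≤ ∑ i, x i ^ 2 := Finset.single_le_sum (f := fun i => x i ^ 2) (fun _ _ => sq_nonneg _) (Finset.mem_univ i)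
  rw [Real.norm_eq_abs]
  exact abs_le_one_iff_mul_self_le_one.2 (by nlinarith)

lemma rot_int (ν : Measure (Fin d → ℝ)) [IsProbabilityMeasure ν]
    (hs : ∀ᵐ x ∂ν, ∑ i, x i ^ 2 = 1)
    (hrot : ∀ i j, i ≠ j → ∀ θ, Measure.map (fun x => (rot i j θ).mulVec x) ν = ν)
    (k : ι → Fin d) (S : Finset ι) (i j : Fin d) :
    ∫ x, ∑ s ∈ S, (∏ t ∈ S.erase s, x (k t)) * ((if k s = j then x i else 0) - (if k s = i then x j else 0)) ∂ν = 0 := by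
  by_cases hij : i = j
  · subst hij; simp
  let F : ℝ → (Fin d → ℝ) → ℝ := fun θ x => ∏ s ∈ S, (rot i j θ).mulVec x (k s)
  let F' : ℝ → (Fin d → ℝ) → ℝ := fun θ x => ∑ s ∈ S, (∏ t ∈ S.erase s, (rot i j θ).mulVec x (k t)) *
    ((-Real.sin θ • rA i j + Real.cos θ • rJ i j).mulVec x (k s))
  have hmc : Continuous fun p : ℝ × (Fin d → ℝ) => (rot i j p.1).mulVec p.2 := by
    refine Continuous.matrix_mulVec ?_ continuous_snd
    unfold rot
    fun_prop
  have hm2 : Continuous fun p : ℝ × (Fin d → ℝ) => (-Real.sin p.1 • rA i j + Real.cos p.1 • rJ i j).mulVec p.2 := by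
    refine Continuous.matrix_mulVec ?_ continuous_snd
    fun_prop
  have hF' : Continuous fun p : ℝ × (Fin d → ℝ) => F' p.1 p.2 := by
    refine continuous_finsetSum _ fun s _ => Continuous.mul (continuous_finsetProd _ fun t _ => ?_) ?_
    · exact (continuous_apply _).comp hmc
    · exact (continuous_apply _).comp hm2
  have hF : ∀ θ, Continuous (F θ) := fun θ => by
    refine continuous_finsetProd _ fun t _ => ?_
    exact (continuous_apply _).comp (hmc.comp (by fun_prop : Continuous fun x : Fin d → ℝ => (θ, x)))
  obtain ⟨C, hC⟩ := ((isCompact_closedBall (0:ℝ) 1).prod (isCompact_closedBall (0 : Fin d → ℝ) 1)).exists_bound_of_continuousOn hF'.continuousOn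
  have hd : ∀ x θ, HasDerivAt (fun θ => F θ x) (F' θ x) θ := by
    intro x θ
    simp only [F', ← smul_eq_mul (a := Finset.prod _ _)]
    refine HasDerivAt.fun_finsetProd fun s _ => ?_
    have e : (fun θ => (rot i j θ).mulVec x (k s)) = fun θ => x (k s) + (Real.cos θ - 1) * (rA i j).mulVec x (k s) + Real.sin θ * (rJ i j).mulVec x (k s) := by
      funext θ; simp [rot, Matrix.add_mulVec, Matrix.smul_mulVec]
    rw [e]
    have := ((((Real.hasDerivAt_cos θ).sub_const 1).mul_const ((rA i j).mulVec x (k s))).const_add (x (k s))).add ((Real.hasDerivAt_sin θ).mul_const ((rJ i j).mulVec x (k s)))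
    have e2 : (-Real.sin θ • rA i j + Real.cos θ • rJ i j).mulVec x (k s) =
        -Real.sin θ * (rA i j).mulVec x (k s) + Real.cos θ * (rJ i j).mulVec x (k s) := by
      rw [Matrix.add_mulVec, Matrix.smul_mulVec, Matrix.smul_mulVec]; simp
    rw [e2]
    exact this
  have key := (hasDerivAt_integral_of_dominated_loc_of_deriv_le (μ := ν) (F := F) (F' := F') (x₀ := (0:ℝ)) (s := Metric.ball 0 1) (bound := fun _ => C)
    (Metric.ball_mem_nhds _ one_pos) (Filter.Eventually.of_forall fun θ => (hF θ).aestronglyMeasurable)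
    (int_cont ν hs _ (hF 0))
    (hF'.comp (by fun_prop : Continuous fun x : Fin d → ℝ => ((0:ℝ), x))).aestronglyMeasurable
    (by
      filter_upwards [hs] with x hx θ hθ
      refine hC (θ, x) ⟨Metric.ball_subset_closedBall hθ, ?_⟩
      rw [mem_closedBall_zero_iff, pi_norm_le_iff_of_nonneg zero_le_one]
      intro i
      have : x i ^ 2 ≤ ∑ i, x i ^ 2 := Finset.single_le_sum (f := fun i => x i ^ 2) (fun _ _ => sq_nonneg _) (Finset.mem_univ i)
      rw [Real.norm_eq_abs]
      exact abs_le_one_iff_mul_self_le_one.2 (by nlinarith))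
    (integrable_const C) (Filter.Eventually.of_forall fun x θ _ => hd x θ)).2
  have hconst : (fun θ => ∫ x, F θ x ∂ν) = fun _ => ∫ x, ∏ s ∈ S, x (k s) ∂ν := by
    funext θ
    conv_rhs => rw [← hrot i j hij θ]
    rw [integral_map]
    · exact (by fun_prop : Continuous fun x : Fin d → ℝ => (rot i j θ).mulVec x).aemeasurable
    · exact (by fun_prop : Continuous fun x : Fin d → ℝ => ∏ s ∈ S, x (k s)).aestronglyMeasurable
  rw [hconst] at key
  have := key.unique (hasDerivAt_const _ _)
  refine Eq.trans ?_ this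
  refine integral_congr_ae (Filter.Eventually.of_forall fun x => ?_)
  simp [F', rot, rJ_mulVec]

lemma rec_int (ν : Measure (Fin d → ℝ)) [IsProbabilityMeasure ν]
    (hs : ∀ᵐ x ∂ν, ∑ i, x i ^ 2 = 1)
    (hrot : ∀ i j, i ≠ j → ∀ θ, Measure.map (fun x => (rot i j θ).mulVec x) ν = ν)
    (h : ι → Fin d) (T : Finset ι) (a : ι) (ha : a ∉ T) :
    ((d : ℝ) - 1 + T.card) * ∫ x, x (h a) * ∏ s ∈ T, x (h s) ∂ν =
      ∑ b ∈ T, if h b = h a then ∫ x, ∏ s ∈ T.erase b, x (h s) ∂ν else 0 := by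
  have h1 : ∀ j : Fin d, ∫ x, ((∏ s ∈ T, x (h s)) * (x (h a) - if j = h a then x j else 0) +
      ∑ s ∈ T, (x j * ∏ t ∈ T.erase s, x (h t)) * ((if h s = j then x (h a) else 0) - (if h s = h a then x j else 0))) ∂ν = 0 := by
    intro j
    refine Eq.trans ?_ (rot_int ν hs hrot (Function.update h a j) (insert a T) (h a) j)
    refine integral_congr_ae (Filter.Eventually.of_forall fun x => ?_)
    have hu : ∀ s ∈ T, Function.update h a j s = h s := fun s hs => by
      rw [Function.update_of_ne]; rintro rfl; exact ha hs
    simp only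
    rw [Finset.sum_insert ha, Finset.erase_insert ha]
    congr 1
    · rw [Finset.prod_congr (f := fun s => x (Function.update h a j s)) (g := fun s => x (h s)) rfl fun s hs => by simp only [hu s hs]]
      simp
    · refine Finset.sum_congr rfl fun s hsT => ?_
      have hsa : a ≠ s := by rintro rfl; exact ha hsT
      rw [Finset.erase_insert_of_ne hsa, Finset.prod_insert (by grind), hu s hsT,
        Finset.prod_congr (f := fun s => x (Function.update h a j s)) (g := fun s => x (h s)) rfl fun t ht => by simp only [hu t (Finset.mem_of_mem_erase ht)]]
      simp
  have h2 := Finset.sum_congr rfl fun j (_ : j ∈ (Finset.univ : Finset (Fin d))) => h1 j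
  rw [← integral_finsetSum _ fun j _ => int_cont ν hs _ (by
    refine Continuous.add (by split_ifs <;> fun_prop) (continuous_finsetSum _ fun s _ => ?_)
    split_ifs <;> fun_prop)] at h2
  have h3 : ∀ᵐ x ∂ν, (∑ j : Fin d, ((∏ s ∈ T, x (h s)) * (x (h a) - if j = h a then x j else 0) +
      ∑ s ∈ T, (x j * ∏ t ∈ T.erase s, x (h t)) * ((if h s = j then x (h a) else 0) - (if h s = h a then x j else 0))))
      = ((d : ℝ) - 1 + T.card) * (x (h a) * ∏ s ∈ T, x (h s)) - ∑ b ∈ T, (if h b = h a then 1 else 0) * ∏ s ∈ T.erase b, x (h s) := by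
    filter_upwards [hs] with x hx
    rw [Finset.sum_add_distrib, ← Finset.mul_sum, Finset.sum_sub_distrib, Finset.sum_comm]
    have : ∀ s ∈ T, ∑ j, (x j * ∏ t ∈ T.erase s, x (h t)) * ((if h s = j then x (h a) else 0) - (if h s = h a then x j else 0))
       = x (h a) * ∏ s ∈ T, x (h s) - (if h s = h a then 1 else 0) * ∏ t ∈ T.erase s, x (h t) := by
      intro s hsT
      rw [← Finset.mul_prod_erase T _ hsT]
      simp only [mul_sub, Finset.sum_sub_distrib]
      congr 1
      · simp; ring
      · split_ifs
        · simp only [mul_right_comm, ← Finset.sum_mul, ← pow_two, hx]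
        · simp
    rw [Finset.sum_congr rfl this, Finset.sum_sub_distrib]
    simp
    ring
  rw [integral_congr_ae h3, integral_sub (int_cont ν hs _ (by fun_prop)) (int_cont ν hs _ (by fun_prop)),
    integral_const_mul, integral_finsetSum _ fun j _ => int_cont ν hs _ (by fun_prop)] at h2
  simp only [integral_const_mul, Finset.sum_const_zero, sub_eq_zero] at h2
  rw [h2]
  simp

lemma wick (hd : 1 ≤ d) (ν : Measure (Fin d → ℝ)) [IsProbabilityMeasure ν]
    (hs : ∀ᵐ x ∂ν, ∑ i, x i ^ 2 = 1)
    (hrot : ∀ i j, i ≠ j → ∀ θ, Measure.map (fun x => (rot i j θ).mulVec x) ν = ν)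
    (h : ι → Fin d) (n : ℕ) : ∀ (S : Finset ι), S.card = 2 * n →
    ∫ x, ∏ s ∈ S, x (h s) ∂ν = (Real.Gamma ((d : ℝ) / 2) / (2 ^ n * Real.Gamma ((n : ℝ) + (d : ℝ) / 2))) * (Wset h S).card := by
  have hd0 : (0:ℝ) < d := by exact_mod_cast hd
  induction n with
  | zero =>
    intro S hS
    obtain rfl : S = ∅ := by simpa using hS
    have := (Real.Gamma_pos_of_pos (half_pos hd0)).ne'
    simp [W_empty, this]
  | succ n ih =>
    intro S hS
    obtain ⟨a, ha⟩ : S.Nonempty := by rw [← Finset.card_pos]; omega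
    have hc : (S.erase a).card = 2 * n + 1 := by rw [Finset.card_erase_of_mem ha]; omega
    have h1 := rec_int ν hs hrot h (S.erase a) a (Finset.notMem_erase a S)
    have h0 : ∀ x : Fin d → ℝ, x (h a) * ∏ s ∈ S.erase a, x (h s) = ∏ s ∈ S, x (h s) :=
      fun x => Finset.mul_prod_erase S (fun s => x (h s)) ha
    simp only [h0] at h1
    have h2 : ∀ b ∈ S.erase a, (if h b = h a then ∫ x, ∏ s ∈ (S.erase a).erase b, x (h s) ∂ν else 0)
       = (Real.Gamma ((d : ℝ) / 2) / (2 ^ n * Real.Gamma ((n : ℝ) + (d : ℝ) / 2))) * ((if h b = h a then (Wset h ((S.erase a).erase b)).card else 0 : ℕ) : ℝ) := by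
      intro b hb
      split_ifs
      · exact ih _ (by rw [Finset.card_erase_of_mem hb]; omega)
      · simp
    rw [Finset.sum_congr rfl h2, ← Finset.mul_sum, ← Nat.cast_sum, ← W_rec h S a ha, hc] at h1
    have hp : (0:ℝ) < n + d / 2 := by positivity
    have hG := Real.Gamma_add_one hp.ne'
    have hG0 := (Real.Gamma_pos_of_pos hp).ne'
    have e : ((n + 1 : ℕ) : ℝ) + (d : ℝ) / 2 = n + d / 2 + 1 := by push_cast; ring
    have e2 : (d : ℝ) - 1 + ((2 * n + 1 : ℕ) : ℝ) = 2 * (n + d / 2) := by push_cast; ring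
    rw [e2] at h1
    rw [e, hG]
    have : (2 * ((n:ℝ) + d / 2)) ≠ 0 := by positivity
    apply mul_left_cancel₀ this
    rw [h1]
    have := hp.ne'
    generalize (n:ℝ) + d / 2 = q at *
    field_simp
    ring
end aux

/-- The `N`-th moment operator of the uniform measure on the real unit sphere
(embedded in `ℂ^d`) equals `(Γ(d/2)/(2^N Γ(N + d/2))) Σ_{M ∈ M_{2N}} σ_M`, where `M_{2N}`
ranges over perfect matchings of the `2N` tensor indices (equivalently, fixed-point-free
involutions `π` of `Fin N ⊕ Fin N`) and `σ_M` contracts matched indices. -/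
theorem real_sphere_moment_formula (d N : ℕ) (hd : 1 ≤ d)
    [MeasurableSpace (EuclideanSpace ℂ (Fin d))] [BorelSpace (EuclideanSpace ℂ (Fin d))]
    (μ : Measure (EuclideanSpace ℂ (Fin d))) [IsProbabilityMeasure μ]
    (hsupp : μ ({x : EuclideanSpace ℂ (Fin d) | ‖x‖ = 1 ∧ ∀ i, (x i).im = 0} : Set _)ᶜ = 0)
    (hinv : ∀ O : Matrix.orthogonalGroup (Fin d) ℝ,
      Measure.map (fun x =>
        Matrix.toEuclideanLin ((O : Matrix (Fin d) (Fin d) ℝ).map Complex.ofReal) x) μ = μ) :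
    ∀ f g : Fin N → Fin d,
      (∫ x, (∏ k, x (f k) * star (x (g k))) ∂μ)
        = ((Real.Gamma ((d : ℝ) / 2) / (2 ^ N * Real.Gamma ((N : ℝ) + (d : ℝ) / 2)) : ℝ) : ℂ) *
          ∑ π : Equiv.Perm (Fin N ⊕ Fin N),
            if Function.Involutive π ∧ (∀ i, π i ≠ i) ∧
                (∀ i, Sum.elim f g i = Sum.elim f g (π i))
            then (1 : ℂ) else 0 := by
  intro f g
  let φ : EuclideanSpace ℂ (Fin d) → (Fin d → ℝ) := fun x i => (x i).re
  have hφ : Continuous φ := by fun_prop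
  have hsup : ∀ᵐ x ∂μ, ‖x‖ = 1 ∧ ∀ i, (x i).im = 0 := hsupp
  have : IsProbabilityMeasure (μ.map φ) := Measure.isProbabilityMeasure_map hφ.aemeasurable
  have hs : ∀ᵐ x ∂(μ.map φ), ∑ i, x i ^ 2 = 1 := by
    rw [ae_map_iff hφ.aemeasurable (measurableSet_eq_fun (by fun_prop) (by fun_prop))]
    filter_upwards [hsup] with x hx
    have h1 := EuclideanSpace.norm_sq_eq x
    rw [hx.1] at h1
    rw [show (1:ℝ) = 1 ^ 2 by norm_num, h1]
    refine Finset.sum_congr rfl fun i _ => ?_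
    rw [← Complex.normSq_eq_norm_sq, Complex.normSq_apply, hx.2 i]
    simp [φ, pow_two]
  have hrot : ∀ i j, i ≠ j → ∀ θ, Measure.map (fun x => (rot i j θ).mulVec x) (μ.map φ) = μ.map φ := by
    intro i j hij θ
    have h1 := hinv ⟨rot i j θ, rot_mem i j hij θ⟩
    have hT : Continuous (fun x => Matrix.toEuclideanLin ((rot i j θ).map Complex.ofReal) x) :=
      LinearMap.continuous_of_finiteDimensional _
    conv_rhs => rw [← h1]
    rw [Measure.map_map (by fun_prop : Continuous fun x : Fin d → ℝ => (rot i j θ).mulVec x).measurable hφ.measurable,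
      Measure.map_map hφ.measurable hT.measurable]
    congr 1
    funext x p
    simp [φ, Matrix.mulVec, dotProduct, Matrix.toLpLin_apply]
  have hw := wick hd (μ.map φ) hs hrot (Sum.elim f g) N Finset.univ (by simp; ring)
  rw [integral_map hφ.aemeasurable
    (by fun_prop : Continuous fun x : Fin d → ℝ => ∏ s, x (Sum.elim f g s)).aestronglyMeasurable] at hw
  have e : (∫ x, (∏ k, x (f k) * star (x (g k))) ∂μ) =
      ∫ x, ((∏ s, φ x (Sum.elim f g s) : ℝ) : ℂ) ∂μ := by
    refine integral_congr_ae ?_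
    filter_upwards [hsup] with x hx
    have hr : ∀ i, x i = ((x i).re : ℂ) := fun i => Complex.ext rfl (by simp [hx.2 i])
    rw [Fintype.prod_sum_type, ← Finset.prod_mul_distrib, Complex.ofReal_prod]
    refine Finset.prod_congr rfl fun k _ => ?_
    rw [hr (f k), hr (g k)]
    simp [φ]
  rw [e, integral_complex_ofReal, hw, Complex.ofReal_mul]
  congr 1
  rw [Finset.sum_boole, Complex.ofReal_natCast]
  congr 2
  ext π
  rw [mem_Wset, Finset.mem_filter]
  simp
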